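/- For all integers k ≥ 1, m ≥ 1, and n ≥ 2m + 2k, p^{2k+1}_{2,1}(m,n) = p^{2k+1}_{2,1}(m-1, n - 2m - 2k) + p^{2k+1}_{2,2}(m, n - 2m), where p^{2k+1}_{2,i}(m,n) counts partitions of n with exactly m parts, all parts at least 2k+1, at most i-1 parts equal to 2k+1, every even part at least 2(m+k), and odd parts (in decreasing order) satisfying λ_{j_ℓ} - λ_{j_{ℓ+2}} ≥ 4. -/

import Mathlib

/-!
Formalization of statements from "Even-Odd partition identities of
Rogers-Ramanujan type" (P. Afsharijoo).

A partition of `n` is modelled by Mathlib's `Nat.Partition n` (a multiset of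
positive parts summing to `n`).  Sorted-in-increasing-order lists of parts are
used to express the conditions on consecutive parts of the decreasing
enumeration `λ_1 ≥ λ_2 ≥ …`.
-/

/-- The parts of a partition, sorted in increasing order. -/
def Nat.Partition.sortedParts {n : ℕ} (p : n.Partition) : List ℕ :=
  p.parts.sort (· ≤ ·)

/-- The odd parts of a partition, sorted in increasing order. -/
def Nat.Partition.oddParts {n : ℕ} (p : n.Partition) : List ℕ :=
  (p.parts.filter (fun x => ¬ Even x)).sort (· ≤ ·)

/-- The even parts of a partition, sorted in increasing order. -/
def Nat.Partition.evenParts {n : ℕ} (p : n.Partition) : List ℕ :=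
  (p.parts.filter (fun x => Even x)).sort (· ≤ ·)

/-- `GapCond L d g` : any two entries of `L` lying `d` positions apart differ by at
least `g`.  When `L` lists parts in increasing order, this says that the
corresponding decreasing enumeration `λ_1 ≥ λ_2 ≥ …` satisfies
`λ_ℓ - λ_{ℓ+d} ≥ g` for every valid index `ℓ`.
In particular `GapCond p.sortedParts 1 2` says that any two parts of `p`
differ by at least `2` (no equal and no consecutive parts), and
`GapCond p.oddParts 2 4` says that the odd parts satisfy
`λ_{j_ℓ} - λ_{j_{ℓ+2}} ≥ 4`. -/
def GapCond (L : List ℕ) (d g : ℕ) : Prop :=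
  ∀ ℓ : ℕ, ℓ + d < L.length → g ≤ L[ℓ + d]! - L[ℓ]!

/-- `p2k1 k i m n` = number of partitions of `n` with exactly `m` parts, all parts
at least `2k+1`, at most `i - 1` parts equal to `2k+1`, every even part at least
`2(m+k)`, and odd parts (in decreasing order) satisfying
`λ_{j_ℓ} - λ_{j_{ℓ+2}} ≥ 4`. -/
noncomputable def p2k1 (k i m n : ℕ) : ℕ :=
  Nat.card {p : n.Partition //
    Multiset.card p.parts = m ∧
    (∀ x ∈ p.parts, 2 * k + 1 ≤ x) ∧
    Multiset.count (2 * k + 1) p.parts ≤ i - 1 ∧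
    (∀ x ∈ p.parts, Even x → 2 * (m + k) ≤ x) ∧
    GapCond p.oddParts 2 4}

/-- Multisets with `m` entries and sum `N - r`, odd entries at least `o`, even entries at least
`e`, and at most two entries in each window `{a, a + 2}` with `a` odd. -/
def gapMultisets (o e m r N : ℕ) : Set (Multiset ℕ) :=
  {s | Multiset.card s = m ∧ s.sum + r = N ∧ (∀ x ∈ s, Odd x → o ≤ x) ∧
    (∀ x ∈ s, Even x → e ≤ x) ∧ ∀ a, Odd a → s.count a + s.count (a + 2) ≤ 2}

theorem gapMultisets_finite (o e m r N : ℕ) : (gapMultisets o e m r N).Finite := by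
  refine (Set.finite_Iic (m • Multiset.range (N + 1))).subset ?_
  rintro s ⟨hc, hs, -⟩
  rw [Set.mem_Iic, Multiset.le_iff_count]
  intro a
  by_cases ha : a ∈ s
  · have h1 : a ≤ s.sum := Multiset.single_le_sum (fun _ _ => Nat.zero_le _) a ha
    have h2 : (Multiset.range (N + 1)).count a = 1 :=
      Multiset.count_eq_one_of_mem (Multiset.nodup_range _) (by rw [Multiset.mem_range]; omega)
    have h3 := Multiset.count_le_card a s
    rw [Multiset.count_nsmul, h2]
    omega
  · simp [Multiset.count_eq_zero_of_notMem ha]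

theorem gapCond_cons_cons_cons (x y z : ℕ) (L : List ℕ) :
    GapCond (x :: y :: z :: L) 2 4 ↔ 4 ≤ z - x ∧ GapCond (y :: z :: L) 2 4 := by
  constructor
  · intro h
    refine ⟨by simpa using h 0 (by simp), fun l hl => ?_⟩
    simpa [Nat.add_right_comm] using h (l + 1) (by simp at hl ⊢; omega)
  · rintro ⟨h0, h⟩ l hl
    cases l with
    | zero => simpa using h0
    | succ l => simpa [Nat.add_right_comm] using h l (by simp at hl ⊢; omega)

theorem gapCond_iff_count (L : List ℕ) (hs : L.Pairwise (· ≤ ·)) (ho : ∀ x ∈ L, Odd x) :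
    GapCond L 2 4 ↔ ∀ a, Odd a → L.count a + L.count (a + 2) ≤ 2 := by
  induction L with
  | nil => simp [GapCond]
  | cons x L ih =>
    match L, ih with
    | [], _ =>
      refine iff_of_true (fun l hl => by simp at hl) fun a _ => ?_
      simp only [List.count_cons, List.count_nil]
      split_ifs <;> omega
    | [y], _ =>
      refine iff_of_true (fun l hl => by simp at hl) fun a _ => ?_
      simp only [List.count_cons, List.count_nil, beq_iff_eq]
      split_ifs <;> omega
    | y :: z :: L, ih =>
      rw [gapCond_cons_cons_cons, ih hs.of_cons fun w hw => ho w (List.mem_cons_of_mem _ hw)]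
      simp only [List.pairwise_cons, List.mem_cons, forall_eq_or_imp] at hs ho
      obtain ⟨⟨hxy, hxz, hxL⟩, ⟨hyz, hyL⟩, hzL, -⟩ := hs
      obtain ⟨hox, hoy, hoz, -⟩ := ho
      have hx : Odd x := hox
      rw [Nat.odd_iff] at hox hoy hoz
      constructor
      · rintro ⟨h4, h⟩ a ha
        have hlt : ∀ b, b < x + 4 → L.count b = 0 := fun b hb =>
          List.count_eq_zero.2 fun hbL => by have := hzL b hbL; omega
        have h' := h a ha
        simp only [List.count_cons, beq_iff_eq] at h' ⊢
        rw [Nat.odd_iff] at ha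
        by_cases hax : a ≤ x
        · rw [hlt a (by omega), hlt (a + 2) (by omega)]
          split_ifs <;> omega
        · rw [if_neg (show ¬ x = a by omega), if_neg (show ¬ x = a + 2 by omega)]
          exact h'
      · refine fun h => ⟨?_, fun a ha => ?_⟩
        · have h' := h x hx
          simp only [List.count_cons, beq_iff_eq] at h'
          by_contra hlt
          have hz : z = x ∨ z = x + 2 := by omega
          have hy : y = x ∨ y = x + 2 := by omega
          split_ifs at h' <;> omega
        · have h' := h a ha
          rw [List.count_cons (a := a), List.count_cons (a := a + 2)] at h'
          omega

theorem Nat.Partition.gapCond_oddParts_iff {n : ℕ} (p : n.Partition) :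
    GapCond p.oddParts 2 4 ↔
      ∀ a, Odd a → p.parts.count a + p.parts.count (a + 2) ≤ 2 := by
  rw [gapCond_iff_count]
  · refine forall₂_congr fun a ha => ?_
    have ha' : Odd (a + 2) := ha.add_even even_two
    rw [← Multiset.coe_count, ← Multiset.coe_count, Nat.Partition.oddParts, Multiset.sort_eq,
      Multiset.count_filter_of_pos (by simpa using ha),
      Multiset.count_filter_of_pos (by simpa using ha')]
  · exact Multiset.pairwise_sort _ _
  · intro x hx
    rw [Nat.Partition.oddParts, Multiset.mem_sort, Multiset.mem_filter] at hx
    exact Nat.not_even_iff_odd.1 hx.2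

theorem card_partition_eq_ncard (n : ℕ) (P : Multiset ℕ → Prop) :
    Nat.card {p : n.Partition // P p.parts} =
      {s : Multiset ℕ | (∀ x ∈ s, 0 < x) ∧ s.sum = n ∧ P s}.ncard :=
  Nat.card_congr
    { toFun := fun p => ⟨p.1.parts, fun _ hx => p.1.parts_pos hx, p.1.parts_sum, p.2⟩
      invFun := fun s => ⟨⟨s.1, fun {_} hx => s.2.1 _ hx, s.2.2.1⟩, s.2.2.2⟩
      left_inv := fun _ => rfl
      right_inv := fun _ => rfl }

theorem p2k1_eq_ncard (k i m n r N : ℕ) (h : n + r = N) :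
    p2k1 k i m n =
      {s ∈ gapMultisets (2 * k + 1) (2 * (m + k)) m r N | s.count (2 * k + 1) ≤ i - 1}.ncard := by
  unfold p2k1
  simp only [Nat.Partition.gapCond_oddParts_iff]
  rw [card_partition_eq_ncard n fun s => Multiset.card s = m ∧ (∀ x ∈ s, 2 * k + 1 ≤ x) ∧
    s.count (2 * k + 1) ≤ i - 1 ∧ (∀ x ∈ s, Even x → 2 * (m + k) ≤ x) ∧
    ∀ a, Odd a → s.count a + s.count (a + 2) ≤ 2]
  congr 1
  ext s
  simp only [gapMultisets, Set.mem_ofPred_eq]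
  constructor
  · rintro ⟨-, hs, hc, hge, hi, he, hg⟩
    exact ⟨⟨hc, by omega, fun x hx _ => hge x hx, he, hg⟩, hi⟩
  · rintro ⟨⟨hc, hs, ho, he, hg⟩, hi⟩
    have hge : ∀ x ∈ s, 2 * k + 1 ≤ x := fun x hx => by
      have := Multiset.card_pos_iff_exists_mem.2 ⟨x, hx⟩
      rcases Nat.even_or_odd x with h' | h'
      · have := he x hx h'
        omega
      · exact ho x hx h'
    exact ⟨fun x hx => by have := hge x hx; omega, by omega, hc, hge, hi, he, hg⟩

theorem p2k1_one_eq_ncard (k m n r N : ℕ) (h : n + r = N) :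
    p2k1 k 1 m n = (gapMultisets (2 * k + 3) (2 * (m + k)) m r N).ncard := by
  rw [p2k1_eq_ncard k 1 m n r N h]
  congr 1
  ext s
  simp only [gapMultisets, Set.mem_ofPred_eq, Nat.sub_self, Nat.le_zero, Multiset.count_eq_zero]
  constructor
  · rintro ⟨⟨hc, hs, ho, he, hg⟩, hi⟩
    refine ⟨hc, hs, fun x hx hx' => ?_, he, hg⟩
    have h1 := ho x hx hx'
    have h2 : x ≠ 2 * k + 1 := fun h => hi (h ▸ hx)
    rw [Nat.odd_iff] at hx'
    omega
  · rintro ⟨hc, hs, ho, he, hg⟩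
    refine ⟨⟨hc, hs, fun x hx hx' => (ho x hx hx').trans' (by omega), he, hg⟩, fun hi => ?_⟩
    have := ho _ hi (odd_two_mul_add_one k)
    omega

theorem map_add_mem_gapMultisets {d : ℕ} (hd : Even d) (o e m r N : ℕ) (t : Multiset ℕ) :
    t.map (· + d) ∈ gapMultisets (o + d) (e + d) m r N ↔ t ∈ gapMultisets o e m (r + m * d) N := by
  have hcount : ∀ a, (t.map (· + d)).count (a + d) = t.count a := fun a =>
    Multiset.count_map_eq_count' _ _ (add_left_injective d) a
  have hodd : ∀ x, Odd (x + d) ↔ Odd x := fun x => by simp [Nat.odd_add, hd]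
  have heven : ∀ x, Even (x + d) ↔ Even x := fun x => by simp [Nat.even_add, hd]
  have hsum : (t.map (· + d)).sum = t.sum + Multiset.card t * d := by
    simp [Multiset.sum_map_add]
  have hgap : (∀ a, Odd a → (t.map (· + d)).count a + (t.map (· + d)).count (a + 2) ≤ 2) ↔
      ∀ a, Odd a → t.count a + t.count (a + 2) ≤ 2 := by
    constructor
    · intro h a ha
      have := h (a + d) ((hodd a).2 ha)
      rwa [add_right_comm, hcount, hcount] at this
    · intro h a ha
      by_cases had : d ≤ a
      · obtain ⟨b, rfl⟩ := Nat.exists_eq_add_of_le' had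
        rw [add_right_comm, hcount, hcount]
        exact h b ((hodd b).1 ha)
      · have h0 : (t.map (· + d)).count a = 0 := Multiset.count_eq_zero.2 fun hmem => by
          obtain ⟨b, -, hb⟩ := Multiset.mem_map.1 hmem
          omega
        rw [h0, zero_add]
        by_cases had' : d ≤ a + 2
        · obtain ⟨b, hb⟩ := Nat.exists_eq_add_of_le' had'
          have hb' : Odd b := by rw [← hodd, ← hb]; exact ha.add_even even_two
          rw [hb, hcount]
          have := h b hb'
          omega
        · refine (Multiset.count_eq_zero.2 fun hmem => ?_).le.trans (Nat.zero_le 2)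
          obtain ⟨b, -, hb⟩ := Multiset.mem_map.1 hmem
          omega
  simp only [gapMultisets, Set.mem_ofPred_eq, hgap, hsum, Multiset.card_map,
    Multiset.forall_mem_map_iff, hodd, heven, Nat.add_le_add_iff_right]
  refine and_congr_right fun hc => and_congr_left' ?_
  rw [hc]
  omega

theorem exists_map_add_of_mem_gapMultisets {o e m r N d : ℕ} {s : Multiset ℕ}
    (hs : s ∈ gapMultisets (o + d) (e + d) m r N) : ∃ t : Multiset ℕ, t.map (· + d) = s := by
  obtain ⟨-, -, ho, he, -⟩ := hs
  refine ⟨s.map (· - d), ?_⟩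
  rw [Multiset.map_map]
  refine (Multiset.map_congr rfl fun x hx => ?_).trans (Multiset.map_id s)
  have : d ≤ x := by
    rcases Nat.even_or_odd x with h | h
    · exact (he x hx h).trans' (Nat.le_add_left _ _)
    · exact (ho x hx h).trans' (Nat.le_add_left _ _)
  simp [this]

theorem ncard_gapMultisets_shift {d : ℕ} (hd : Even d) (o e m r N : ℕ) (c : ℕ) (P : ℕ → Prop) :
    {s ∈ gapMultisets (o + d) (e + d) m r N | P (s.count (c + d))}.ncard =
      {s ∈ gapMultisets o e m (r + m * d) N | P (s.count c)}.ncard := by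
  rw [eq_comm, ← Set.ncard_image_of_injective _ (Multiset.map_injective (add_left_injective d)),
    eq_comm]
  congr 1
  ext s
  have hcount : ∀ t : Multiset ℕ, (t.map (· + d)).count (c + d) = t.count c := fun t =>
    Multiset.count_map_eq_count' _ _ (add_left_injective d) c
  constructor
  · rintro ⟨hs, hP⟩
    obtain ⟨t, rfl⟩ := exists_map_add_of_mem_gapMultisets hs
    rw [hcount] at hP
    exact ⟨t, ⟨(map_add_mem_gapMultisets hd o e m r N t).1 hs, hP⟩, rfl⟩
  · rintro ⟨t, ⟨ht, hP⟩, rfl⟩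
    refine ⟨(map_add_mem_gapMultisets hd o e m r N t).2 ht, ?_⟩
    rwa [hcount]

theorem ncard_gapMultisets_mem_even {c : ℕ} (hc : Even c) {e : ℕ} (he : e ≤ c) (o m r N : ℕ) :
    {s ∈ gapMultisets o e (m + 1) r N | c ∈ s}.ncard = (gapMultisets o e m (r + c) N).ncard := by
  have key : ∀ t : Multiset ℕ,
      c ::ₘ t ∈ gapMultisets o e (m + 1) r N ↔ t ∈ gapMultisets o e m (r + c) N := fun t => by
    have hcount : ∀ a, Odd a → (c ::ₘ t).count a = t.count a := fun a ha =>
      Multiset.count_cons_of_ne (by rintro rfl; exact Nat.not_even_iff_odd.2 ha hc) t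
    have hgap : (∀ a, Odd a → (c ::ₘ t).count a + (c ::ₘ t).count (a + 2) ≤ 2) ↔
        ∀ a, Odd a → t.count a + t.count (a + 2) ≤ 2 :=
      forall₂_congr fun a ha => by rw [hcount a ha, hcount _ (ha.add_even even_two)]
    have hno : ¬ Odd c := Nat.not_odd_iff_even.2 hc
    simp only [gapMultisets, Set.mem_ofPred_eq, hgap, Multiset.card_cons, Multiset.sum_cons,
      Multiset.mem_cons, forall_eq_or_imp, hno, hc, he, false_imp_iff, true_and, true_imp_iff,
      Nat.add_right_cancel_iff]
    refine and_congr_right fun _ => and_congr_left' ?_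
    omega
  have hinj : Function.Injective (c ::ₘ ·) := fun s t h => by simpa using h
  rw [eq_comm, ← Set.ncard_image_of_injective _ hinj, eq_comm]
  congr 1
  ext s
  constructor
  · rintro ⟨hs, hmem⟩
    obtain ⟨t, rfl⟩ := Multiset.exists_cons_of_mem hmem
    exact ⟨t, (key t).1 hs, rfl⟩
  · rintro ⟨t, ht, rfl⟩
    exact ⟨(key t).2 ht, Multiset.mem_cons_self c t⟩

theorem ncard_gapMultisets_count_eq_two {o : ℕ} (ho : Odd o) (e m r N : ℕ) :
    {s ∈ gapMultisets o e (m + 2) r N | 2 ≤ s.count o}.ncard =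
      (gapMultisets (o + 4) e m (r + 2 * o) N).ncard := by
  have hinj : Function.Injective fun t : Multiset ℕ => o ::ₘ o ::ₘ t := fun s t h => by
    simpa using h
  rw [eq_comm, ← Set.ncard_image_of_injective _ hinj, eq_comm]
  congr 1
  have hne : ¬ Even o := Nat.not_even_iff_odd.2 ho
  ext s
  constructor
  · rintro ⟨hs, h2⟩
    obtain ⟨t, rfl⟩ : ∃ t, s = o ::ₘ o ::ₘ t := by
      obtain ⟨t, ht⟩ := Multiset.le_iff_exists_add.1 (Multiset.le_count_iff_replicate_le.1 h2)
      exact ⟨t, by rw [ht]; simp [Multiset.replicate_succ]⟩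
    obtain ⟨hc, hsum, hodd, heven, hgap⟩ := hs
    refine ⟨t, ⟨by simpa using hc, by simp at hsum; omega, fun x hx hx' => ?_,
      fun x hx => heven x (by simp [hx]), fun a ha => ?_⟩, rfl⟩
    · have h1 := hodd x (by simp [hx]) hx'
      have h3 := hgap o ho
      have h4 := Multiset.count_pos.2 hx
      simp only [Multiset.count_cons] at h3
      have h5 : x ≠ o := by rintro rfl; simp at h3; omega
      have h6 : x ≠ o + 2 := by rintro rfl; simp at h3; omega
      rw [Nat.odd_iff] at ho hx'
      omega
    · have := hgap a ha
      simp only [Multiset.count_cons] at this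
      omega
  · rintro ⟨t, ⟨hc, hsum, hodd, heven, hgap⟩, rfl⟩
    have h0 : ∀ a, Odd a → a < o + 4 → t.count a = 0 := fun a ha hlt =>
      Multiset.count_eq_zero.2 fun hmem => by have := hodd a hmem ha; omega
    refine ⟨⟨by simp [hc], by simp; omega, fun x hx hx' => ?_, fun x hx hx' => ?_,
      fun a ha => ?_⟩, by simp⟩
    · simp only [Multiset.mem_cons] at hx
      rcases hx with rfl | rfl | hx
      · rfl
      · rfl
      · exact (hodd x hx hx').trans' (by omega)
    · simp only [Multiset.mem_cons] at hx
      rcases hx with rfl | rfl | hx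
      · exact absurd hx' hne
      · exact absurd hx' hne
      · exact heven x hx hx'
    · have h1 := hgap a ha
      simp only [Multiset.count_cons]
      by_cases hao : a ≤ o
      · rw [h0 a ha (by omega), h0 (a + 2) (ha.add_even even_two) (by omega)]
        split_ifs <;> omega
      · rw [if_neg (by omega), if_neg (by omega)]
        exact h1

theorem sep_notMem_gapMultisets {e : ℕ} (he : Even e) (o m r N : ℕ) :
    {s ∈ gapMultisets o e m r N | e ∉ s} = gapMultisets o (e + 2) m r N := by
  ext s
  constructor
  · rintro ⟨⟨hc, hs, ho, h, hg⟩, hmem⟩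
    refine ⟨hc, hs, ho, fun x hx hx' => ?_, hg⟩
    have h1 := h x hx hx'
    have h2 : x ≠ e := fun h => hmem (h ▸ hx)
    rw [Nat.even_iff] at he hx'
    omega
  · rintro ⟨hc, hs, ho, h, hg⟩
    refine ⟨⟨hc, hs, ho, fun x hx hx' => (h x hx hx').trans' (by omega), hg⟩, fun hmem => ?_⟩
    have := h e hmem he
    omega

theorem ncard_sep_add_ncard_sep_not {α : Type*} {S : Set α} (hS : S.Finite) (P : α → Prop) :
    {s ∈ S | P s}.ncard + {s ∈ S | ¬ P s}.ncard = S.ncard := by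
  have h : {s ∈ S | ¬ P s} = S \ {s ∈ S | P s} := by
    ext s
    simp only [Set.mem_ofPred_eq, Set.mem_sdiff]
    tauto
  rw [h, add_comm]
  exact Set.ncard_sdiff_add_ncard_of_subset (Set.sep_subset _ _) hS

/-- Splitting according to whether the least admissible even part occurs. -/
theorem ncard_gapMultisets_succ {e : ℕ} (he : Even e) (o m r N : ℕ) :
    (gapMultisets o e (m + 1) r N).ncard =
      (gapMultisets o e m (r + e) N).ncard + (gapMultisets o (e + 2) (m + 1) r N).ncard := by
  rw [← ncard_sep_add_ncard_sep_not (gapMultisets_finite _ _ _ _ _) fun s => e ∈ s,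
    ncard_gapMultisets_mem_even he le_rfl, sep_notMem_gapMultisets he]

theorem gapMultisets_zero (o e e' r N : ℕ) : gapMultisets o e 0 r N = gapMultisets o e' 0 r N := by
  ext s
  simp only [gapMultisets, Set.mem_ofPred_eq, Multiset.card_eq_zero]
  refine and_congr_right ?_
  rintro rfl
  simp

/-- For `k ≥ 1`, `m ≥ 1` and `n ≥ 2m + 2k`,
`p^{2k+1}_{2,1}(m,n) = p^{2k+1}_{2,1}(m-1, n - 2m - 2k) + p^{2k+1}_{2,2}(m, n - 2m)`. -/
theorem p2k1_recursion_sum (k m n : ℕ) (hk : 1 ≤ k) (hm : 1 ≤ m)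
    (hn : 2 * m + 2 * k ≤ n) :
    p2k1 k 1 m n =
      p2k1 k 1 (m - 1) (n - 2 * m - 2 * k) + p2k1 k 2 m (n - 2 * m) := by
  obtain ⟨m, rfl⟩ := Nat.exists_eq_add_of_le' hm
  rw [p2k1_one_eq_ncard k (m + 1) n 0 n rfl,
    p2k1_one_eq_ncard k (m + 1 - 1) _ (2 * (m + 1) + 2 * k) n (by omega),
    p2k1_eq_ncard k 2 (m + 1) _ (0 + (m + 1) * 2) n (by omega), Nat.add_sub_cancel,
    ← ncard_gapMultisets_shift even_two _ _ _ _ _ (2 * k + 1) (· ≤ 2 - 1),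
    ncard_gapMultisets_succ (even_two_mul _),
    ← ncard_sep_add_ncard_sep_not
      (gapMultisets_finite (2 * k + 3) (2 * (m + 1 + k) + 2) (m + 1) 0 n)
      fun s => s.count (2 * k + 1 + 2) ≤ 2 - 1]
  have h3 : 2 * k + 1 + 2 = 2 * k + 3 := rfl
  simp only [Nat.not_le, h3, Nat.reduceSub]
  have hC : {s ∈ gapMultisets (2 * k + 3) (2 * (m + 1 + k) + 2) (m + 1) 0 n |
      1 < s.count (2 * k + 3)}.ncard + (gapMultisets (2 * k + 3) (2 * (m + 1 + k)) m
        (0 + 2 * (m + 1 + k)) n).ncard =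
      (gapMultisets (2 * k + 3) (2 * (m + k)) m (2 * (m + 1) + 2 * k) n).ncard := by
    have hr : 2 * (m + 1) + 2 * k = 0 + 2 * (m + 1 + k) := by omega
    rw [hr]
    cases m with
    | zero =>
      rw [gapMultisets_zero _ (2 * (0 + k)) (2 * (0 + 1 + k)), Nat.add_eq_right,
        Set.ncard_eq_zero ((gapMultisets_finite _ _ _ _ _).sep _), Set.eq_empty_iff_forall_notMem]
      rintro s ⟨⟨hc, -⟩, h⟩
      have := Multiset.count_le_card (2 * k + 3) s
      omega
    | succ m =>
      have ho : Odd (2 * k + 3) := ⟨k + 1, by omega⟩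
      have h4 : Even 4 := by decide
      have hshift := ncard_gapMultisets_shift h4 (2 * k + 3) (2 * (m + 1 + k)) m
        (0 + 2 * (2 * k + 3)) n 0 fun _ => True
      simp only [and_true, Set.ofPred_mem_eq] at hshift
      rw [ncard_gapMultisets_succ (even_two_mul (m + 1 + k))]
      have he : 2 * (m + 1 + 1 + k) + 2 = 2 * (m + 1 + k) + 4 := by omega
      have he' : 2 * (m + 1 + 1 + k) = 2 * (m + 1 + k) + 2 := by omega
      have hr' : 0 + 2 * (2 * k + 3) + m * 4 = 0 + 2 * (m + 1 + 1 + k) + 2 * (m + 1 + k) := by omega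
      have htwo := ncard_gapMultisets_count_eq_two ho (2 * (m + 1 + k) + 4) m 0 n
      rw [hshift, hr'] at htwo
      rw [he]
      exact congrArg₂ (· + ·) htwo (by rw [he'])
  omega
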